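/- arXiv:1102.4251 — 3 statements merged into one kernel-verified Lean document; each statement's English description precedes it below -/
import Mathlib

section
/- Let n ≥ 3 and 1 ≤ k ≤ n−2, and let Λ = ℤv₁ + ⋯ + ℤv_k be the rank-k lattice spanned by ℝ-linearly independent vectors v₁, …, v_k ∈ ℝⁿ. For every x ∈ ℝⁿ∖Λ the family ((x+ω)/|x+ω|ⁿ)_{ω∈Λ} is summable in ℝⁿ, and the function g : ℝⁿ∖Λ → ℝⁿ defined by g(x) = Σ_{ω∈Λ} (x+ω)/|x+ω|ⁿ satisfies g(x+v) = g(x) for every v ∈ Λ and every x ∈ ℝⁿ∖Λ. -/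
noncomputable section

abbrev Euc (n : ℕ) := EuclideanSpace ℝ (Fin n)

/-- The lattice point `m₁v₁ + ⋯ + m_kv_k` associated to integer coefficients `m`. -/
def latt {n k : ℕ} (v : Fin k → Euc n) (m : Fin k → ℤ) : Euc n :=
  ∑ i, (m i : ℝ) • v i

/-- The lattice `Λ = ℤv₁ + ⋯ + ℤv_k` spanned by the vectors `v i`. -/
def lattice {n k : ℕ} (v : Fin k → Euc n) : Set (Euc n) := Set.range (latt v)

/-- The `ℤ`-span of a finite linearly independent family in a finite-dimensional real vector
space is discrete. -/
theorem LinearIndependent.discreteTopology_span_int {E ι : Type*} [NormedAddCommGroup E]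
    [NormedSpace ℝ E] [FiniteDimensional ℝ E] {v : ι → E} (hv : LinearIndependent ℝ v) :
    DiscreteTopology (Submodule.span ℤ (Set.range v)) := by
  let b := Module.Basis.extend hv.linearIndepOn_id
  have : Finite (hv.linearIndepOn_id.extend (Set.subset_univ _)) :=
    Module.Finite.finite_basis b
  have hsub : (Submodule.span ℤ (Set.range v) : Set E) ⊆ Submodule.span ℤ (Set.range b) := by
    rw [SetLike.coe_subset_coe, Module.Basis.range_extend]
    exact Submodule.span_mono (LinearIndepOn.subset_extend _ _)
  exact DiscreteTopology.of_subset
    (inferInstanceAs (DiscreteTopology (Submodule.span ℤ (Set.range b)))) hsub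

theorem lattice_eq_span {n k : ℕ} (v : Fin k → Euc n) :
    lattice v = (Submodule.span ℤ (Set.range v) : Set (Euc n)) := by
  ext x
  simp [lattice, latt, Submodule.mem_span_range_iff_exists_fun, Int.cast_smul_eq_zsmul]

theorem norm_inv_pow_smul_self {E : Type*} [NormedAddCommGroup E] [NormedSpace ℝ E] {n : ℕ}
    (hn : 2 ≤ n) (y : E) : ‖(‖y‖ ^ n)⁻¹ • y‖ = ‖y‖⁻¹ ^ (n - 1) := by
  obtain ⟨m, rfl⟩ := Nat.exists_eq_add_of_le' hn
  rcases eq_or_ne y 0 with rfl | hy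
  · simp
  · have : ‖y‖ ≠ 0 := norm_ne_zero_iff.mpr hy
    rw [norm_smul, norm_inv, norm_pow, norm_norm]
    rw [show m + 2 - 1 = m + 1 by lia, inv_pow, pow_succ _ (m + 1), mul_inv, mul_assoc,
      inv_mul_cancel₀ this, mul_one]

/-- The lattice sum of the Cauchy kernel converges as soon as the rank is less than `n - 1`. -/
theorem summable_cauchyKernel {E : Type*} [NormedAddCommGroup E] [NormedSpace ℝ E]
    [FiniteDimensional ℝ E] (L : Submodule ℤ E) [DiscreteTopology L] {n : ℕ} (hn : 2 ≤ n)
    (hL : Module.finrank ℤ L < n - 1) (x : E) :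
    Summable fun ω : L => (‖x + (ω : E)‖ ^ n)⁻¹ • (x + (ω : E)) := by
  refine Summable.of_norm ?_
  simp_rw [norm_inv_pow_smul_self hn]
  simpa [add_comm] using ZLattice.summable_norm_sub_inv_pow L (n - 1) hL (-x)

/-- For `n ≥ 3`, `1 ≤ k ≤ n-2` and a rank-`k` lattice `Λ` spanned by linearly
independent `v₁, …, v_k ∈ ℝⁿ`: for every `x ∈ ℝⁿ∖Λ` the family `((x+ω)/|x+ω|ⁿ)_{ω∈Λ}` is
summable in `ℝⁿ`, and `g(x) = Σ_{ω∈Λ} (x+ω)/|x+ω|ⁿ` satisfies `g(x+v) = g(x)` for every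
`v ∈ Λ` and `x ∈ ℝⁿ∖Λ`. -/
theorem stmt1 (n k : ℕ) (hn : 3 ≤ n) (hk1 : 1 ≤ k) (hk2 : k ≤ n - 2)
    (v : Fin k → Euc n) (hv : LinearIndependent ℝ v) :
    (∀ x : Euc n, x ∉ lattice v →
      Summable (fun ω : ↥(lattice v) =>
        (‖x + (ω : Euc n)‖ ^ n)⁻¹ • (x + (ω : Euc n)))) ∧
    (∀ g : Euc n → Euc n,
      (∀ x : Euc n, x ∉ lattice v →
        g x = ∑' ω : ↥(lattice v), (‖x + (ω : Euc n)‖ ^ n)⁻¹ • (x + (ω : Euc n))) →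
      ∀ w ∈ lattice v, ∀ x : Euc n, x ∉ lattice v → g (x + w) = g x) := by
  have : DiscreteTopology (Submodule.span ℤ (Set.range v)) := hv.discreteTopology_span_int
  have hrank : Module.finrank ℤ (Submodule.span ℤ (Set.range v)) = k := by
    simpa using finrank_span_eq_card (hv.restrict_scalars' ℤ)
  rw [lattice_eq_span]
  refine ⟨fun x _ => summable_cauchyKernel _ (by lia) (hrank.trans_lt (by lia)) x, fun g hg w hw x hx => ?_⟩
  have hxw : x + w ∉ Submodule.span ℤ (Set.range v) := by
    rwa [Submodule.add_mem_iff_left _ hw]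
  rw [hg x hx, hg (x + w) hxw]
  refine Eq.trans ?_ ((Equiv.addLeft (⟨w, hw⟩ : Submodule.span ℤ (Set.range v))).tsum_eq
    fun ω => (‖x + (ω : Euc n)‖ ^ n)⁻¹ • (x + (ω : Euc n)))
  simp [add_assoc]
end
end

section
/- Let n ≥ 3 and 1 ≤ k ≤ n−1, and let Λ = ℤv₁ + ⋯ + ℤv_k be the rank-k lattice spanned by ℝ-linearly independent vectors v₁, …, v_k ∈ ℝⁿ. Set g(y) = y/|y|ⁿ for y ∈ ℝⁿ∖{0}. Then for every x ∈ ℝⁿ∖Λ the family (g(x+ω) − g(ω))_{ω ∈ Λ∖{0}} is summable in ℝⁿ; in particular the modified Eisenstein-type series g(x) + Σ_{ω∈Λ∖{0}} (g(x+ω) − g(ω)) converges absolutely for every x ∈ ℝⁿ∖Λ. -/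
noncomputable section

lemma coe_span_range_eq_lattice {n k : ℕ} (v : Fin k → Euc n) :
    (Submodule.span ℤ (Set.range v) : Set (Euc n)) = lattice v := by
  ext y
  simp only [SetLike.mem_coe, Submodule.mem_span_range_iff_exists_fun, lattice, latt,
    Set.mem_range, Int.cast_smul_eq_zsmul]

/-- The `ℤ`-span of linearly independent vectors is contained in the `ℤ`-span of a basis. -/
lemma exists_basis_span_range_le {ι E : Type*} [AddCommGroup E] [Module ℝ E]
    {v : ι → E} (hv : LinearIndependent ℝ v) :
    ∃ (s : Set E) (b : Module.Basis s ℝ E),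
      Submodule.span ℤ (Set.range v) ≤ Submodule.span ℤ (Set.range b) := by
  refine ⟨_, Module.Basis.extend hv.linearIndepOn_id, Submodule.span_mono ?_⟩
  rw [Module.Basis.range_extend]
  exact Module.Basis.subset_extend _

lemma discreteTopology_span_range {ι E : Type*} [NormedAddCommGroup E] [NormedSpace ℝ E]
    [FiniteDimensional ℝ E] {v : ι → E} (hv : LinearIndependent ℝ v) :
    DiscreteTopology (Submodule.span ℤ (Set.range v)) := by
  obtain ⟨s, b, hb⟩ := exists_basis_span_range_le hv
  have : Finite s := Module.Finite.finite_basis b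
  exact DiscreteTopology.of_subset
    (inferInstanceAs (DiscreteTopology (Submodule.span ℤ (Set.range b)))) hb

/-- A difference estimate for the kernel `y ↦ y / ‖y‖ ^ n`. -/
lemma norm_inv_pow_smul_add_sub_le {E : Type*} [NormedAddCommGroup E] [NormedSpace ℝ E]
    {n : ℕ} (hn : 1 ≤ n) {x w : E} (hxw : x + w ≠ 0) (hw : w ≠ 0) (h : ‖x‖ ≤ ‖w‖) :
    ‖(‖x + w‖ ^ n)⁻¹ • (x + w) - (‖w‖ ^ n)⁻¹ • w‖ ≤
      ‖x‖ * (1 + n * 2 ^ (n - 1)) * ‖x + w‖⁻¹ ^ n := by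
  have ha : 0 < ‖x + w‖ := norm_pos_iff.2 hxw
  have hb : 0 < ‖w‖ := norm_pos_iff.2 hw
  have hab : ‖x + w‖ ≤ 2 * ‖w‖ := (norm_add_le x w).trans (by linarith)
  have hdiff : |‖w‖ - ‖x + w‖| ≤ ‖x‖ := by
    simpa [abs_sub_comm] using abs_norm_sub_norm_le (x + w) w
  have hpow : |‖w‖ ^ n - ‖x + w‖ ^ n| ≤ ‖x‖ * n * (2 * ‖w‖) ^ (n - 1) := by
    refine (abs_pow_sub_pow_le _ _ _).trans ?_
    gcongr
    rw [abs_norm, abs_norm]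
    exact max_le (by linarith) hab
  have hsplit : (‖x + w‖ ^ n)⁻¹ • (x + w) - (‖w‖ ^ n)⁻¹ • w =
      (‖x + w‖ ^ n)⁻¹ • x + ((‖x + w‖ ^ n)⁻¹ - (‖w‖ ^ n)⁻¹) • w := by
    module
  have hinv : |(‖x + w‖ ^ n)⁻¹ - (‖w‖ ^ n)⁻¹| * ‖w‖ ≤
      ‖x‖ * (n * 2 ^ (n - 1)) * (‖x + w‖ ^ n)⁻¹ := by
    rw [inv_sub_inv (by positivity) (by positivity), abs_div,
      abs_of_pos (show 0 < ‖x + w‖ ^ n * ‖w‖ ^ n by positivity), div_mul_eq_mul_div,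
      div_le_iff₀ (by positivity)]
    calc |‖w‖ ^ n - ‖x + w‖ ^ n| * ‖w‖
        ≤ ‖x‖ * n * (2 * ‖w‖) ^ (n - 1) * ‖w‖ := by gcongr
      _ = ‖x‖ * (n * 2 ^ (n - 1)) * (‖w‖ ^ (n - 1) * ‖w‖) := by rw [mul_pow]; ring
      _ = ‖x‖ * (n * 2 ^ (n - 1)) * (‖x + w‖ ^ n)⁻¹ * (‖x + w‖ ^ n * ‖w‖ ^ n) := by
        rw [pow_sub_one_mul (by lia)]
        field_simp
  rw [hsplit]
  refine (norm_add_le _ _).trans ?_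
  rw [norm_smul, norm_smul, Real.norm_eq_abs, Real.norm_eq_abs, abs_of_pos (by positivity),
    inv_pow]
  linarith

/-- For `n ≥ 3`, `1 ≤ k ≤ n-1` and a rank-`k` lattice `Λ`, with
`g(y) = y/|y|ⁿ`: for every `x ∈ ℝⁿ∖Λ` the family `(g(x+ω) - g(ω))_{ω∈Λ∖{0}}` is summable
in `ℝⁿ`; in particular the modified Eisenstein-type series
`g(x) + Σ_{ω∈Λ∖{0}} (g(x+ω) - g(ω))` converges absolutely. -/
theorem stmt4 (n k : ℕ) (hn : 3 ≤ n) (hk1 : 1 ≤ k) (hk2 : k ≤ n - 1)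
    (v : Fin k → Euc n) (hv : LinearIndependent ℝ v) :
    ∀ x : Euc n, x ∉ lattice v →
      Summable (fun ω : ↥(lattice v \ {0}) =>
        (‖x + (ω : Euc n)‖ ^ n)⁻¹ • (x + (ω : Euc n))
          - (‖(ω : Euc n)‖ ^ n)⁻¹ • (ω : Euc n)) ∧
      Summable (fun ω : ↥(lattice v \ {0}) =>
        ‖(‖x + (ω : Euc n)‖ ^ n)⁻¹ • (x + (ω : Euc n))
          - (‖(ω : Euc n)‖ ^ n)⁻¹ • (ω : Euc n)‖) := by
  intro x hx
  suffices h : Summable (fun ω : ↥(lattice v \ {0}) =>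
      ‖(‖x + (ω : Euc n)‖ ^ n)⁻¹ • (x + (ω : Euc n))
        - (‖(ω : Euc n)‖ ^ n)⁻¹ • (ω : Euc n)‖) from ⟨h.of_norm, h⟩
  have hΛ := coe_span_range_eq_lattice v
  have hdisc := discreteTopology_span_range hv
  have hrank : Module.finrank ℤ (Submodule.span ℤ (Set.range v)) < n := by
    refine lt_of_le_of_lt (b := k) ?_ (by lia)
    simpa [Set.finrank] using finrank_range_le_card (R := ℤ) v
  let f : ↥(lattice v \ {0}) → Submodule.span ℤ (Set.range v) :=
    fun ω ↦ ⟨ω, hΛ.symm.subset ω.2.1⟩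
  have hf : Function.Injective f := fun a b hab ↦ by simpa [f, Subtype.ext_iff] using hab
  have hsum : Summable fun ω : ↥(lattice v \ {0}) ↦ ‖x + (ω : Euc n)‖⁻¹ ^ n := by
    refine ((ZLattice.summable_norm_sub_inv_pow _ n hrank (-x)).comp_injective hf).congr
      fun ω ↦ ?_
    simp [f, add_comm]
  refine .of_norm_bounded_eventually (hsum.mul_left (‖x‖ * (1 + n * 2 ^ (n - 1)))) ?_
  have hfin : (Metric.closedBall (0 : Euc n) ‖x‖ ∩ lattice v).Finite := by
    obtain ⟨s, b, hb⟩ := exists_basis_span_range_le hv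
    have : Finite s := Module.Finite.finite_basis b
    refine (ZSpan.setFinite_inter b Metric.isBounded_closedBall).subset
      (Set.inter_subset_inter_right _ ?_)
    exact hΛ ▸ hb
  refine (hfin.preimage Subtype.val_injective.injOn).subset fun ω hω ↦ ?_
  refine ⟨?_, ω.2.1⟩
  rw [mem_closedBall_zero_iff]
  by_contra! hlt
  refine hω ?_
  rw [Set.mem_ofPred_eq, norm_norm]
  refine norm_inv_pow_smul_add_sub_le (by lia) (fun h0 ↦ hx ?_) ω.2.2 hlt.le
  rw [← hΛ, eq_neg_of_add_eq_zero_left h0]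
  exact neg_mem (hΛ.symm.subset ω.2.1)
end
end

section
/- Let n ≥ 4 and 1 ≤ k ≤ n−3, and let Λ = ℤv₁ + ⋯ + ℤv_k be the rank-k lattice spanned by ℝ-linearly independent vectors v₁, …, v_k ∈ ℝⁿ whose coordinates k+1, …, n all vanish. For ω = m₁v₁+⋯+m_kv_k ∈ Λ set sgn(ω) = (−1)^{m₁+⋯+m_k} and define the affine isometry γ_ω : ℝⁿ → ℝⁿ by γ_ω(x) = (x₁+ω₁, …, x_k+ω_k, x_{k+1}, …, x_{n−1}, sgn(ω)·x_n). Then: (i) for all x, y ∈ ℝⁿ with γ_ω(x) ≠ y for every ω ∈ Λ, the family (|γ_ω(x) − y|^{2−n})_{ω∈Λ} is summable, so H⁻(x,y) = Σ_{ω∈Λ} |γ_ω(x) − y|^{2−n} is well defined; (ii) H⁻(γ_η(x), y) = H⁻(x, y) for every η ∈ Λ; (iii) for each fixed y, the function x ↦ H⁻(x,y) is harmonic on the open set {x ∈ ℝⁿ : γ_ω(x) ≠ y for all ω ∈ Λ}. -/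
noncomputable section

open Filter Topology

section RieszPotential

variable {E : Type*} [NormedAddCommGroup E] [InnerProductSpace ℝ E]

/-- The real inner product as a continuous bilinear map. -/
def realInnerCLM (E : Type*) [NormedAddCommGroup E] [InnerProductSpace ℝ E] :
    E →L[ℝ] E →L[ℝ] ℝ := innerSL ℝ

theorem realInnerCLM_apply (z w : E) : realInnerCLM E z w = inner ℝ z w := rfl

theorem norm_realInnerCLM_apply (z : E) : ‖realInnerCLM E z‖ = ‖z‖ := innerSL_apply_norm ℝ z

theorem norm_realInnerCLM_le : ‖realInnerCLM E‖ ≤ 1 := norm_innerSL_le ℝ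

/-- The derivative of `z ↦ ‖z‖ ^ s`. -/
def normRpowDeriv (s : ℝ) (z : E) : E →L[ℝ] ℝ := (s * ‖z‖ ^ (s - 2)) • realInnerCLM E z

/-- The second derivative of `z ↦ ‖z‖ ^ s`. -/
def normRpowDerivTwo (s : ℝ) (z : E) : E →L[ℝ] E →L[ℝ] ℝ :=
  (s * ‖z‖ ^ (s - 2)) • realInnerCLM E +
    (s • normRpowDeriv (s - 2) z).smulRight (realInnerCLM E z)

theorem hasFDerivAt_norm_rpow_of_ne (s : ℝ) {z : E} (hz : z ≠ 0) :
    HasFDerivAt (fun z : E => ‖z‖ ^ s) (normRpowDeriv s z) z := by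
  have h := (hasStrictFDerivAt_norm_sq z).hasFDerivAt.rpow_const (p := s / 2)
    (Or.inl (by positivity))
  have e : ∀ (w : E) (t : ℝ), (‖w‖ ^ 2) ^ t = ‖w‖ ^ (2 * t) := fun w t => by
    rw [Real.rpow_mul (norm_nonneg w)]; norm_num
  simp only [e] at h
  convert h using 1
  · ext w
    congr 1; ring
  · ext w
    simp only [normRpowDeriv, smul_apply, smul_eq_mul, nsmul_eq_mul,
      realInnerCLM_apply, innerSL_apply_apply]
    rw [show 2 * (s / 2 - 1) = s - 2 by ring]
    push_cast
    ring

theorem hasFDerivAt_normRpowDeriv (s : ℝ) {z : E} (hz : z ≠ 0) :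
    HasFDerivAt (normRpowDeriv (E := E) s) (normRpowDerivTwo s z) z :=
  ((hasFDerivAt_norm_rpow_of_ne (s - 2) hz).const_mul s).fun_smul
    (realInnerCLM E).hasFDerivAt

/-- Stated for a general codomain `F`: the instance search does not succeed directly for
`F = E →L[ℝ] ℝ`. -/
theorem continuousAdd_continuousLinearMap {F : Type*} [NormedAddCommGroup F] [NormedSpace ℝ F] :
    ContinuousAdd (E →L[ℝ] F) := inferInstance

theorem norm_smul_continuousLinearMap {F : Type*} [NormedAddCommGroup F] [NormedSpace ℝ F]
    (a : ℝ) (A : E →L[ℝ] F) : ‖a • A‖ = ‖a‖ * ‖A‖ := norm_smul a A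

theorem continuousAt_normRpowDerivTwo (s : ℝ) {z : E} (hz : z ≠ 0) :
    ContinuousAt (normRpowDerivTwo (E := E) s) z := by
  have h1 : ContinuousAt (fun z : E => ‖z‖ ^ (s - 2)) z :=
    (hasFDerivAt_norm_rpow_of_ne (s - 2) hz).continuousAt
  have h2 : ContinuousAt (normRpowDeriv (E := E) (s - 2)) z :=
    (hasFDerivAt_normRpowDeriv (s - 2) hz).continuousAt
  have h3 : ContinuousAt (fun z : E => realInnerCLM E z) z :=
    (realInnerCLM E).continuous.continuousAt
  have h4 := ((ContinuousLinearMap.smulRightL ℝ E (E →L[ℝ] ℝ)).continuous.continuousAt.comp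
    (h2.const_smul s)).clm_apply h3
  have h5 := (continuousAt_const (y := s)).mul h1 |>.smul
    (continuousAt_const (y := realInnerCLM E))
  have : ContinuousAdd (E →L[ℝ] E →L[ℝ] ℝ) := continuousAdd_continuousLinearMap (F := E →L[ℝ] ℝ)
  exact h5.add h4

theorem norm_normRpowDeriv (s : ℝ) {z : E} (hz : z ≠ 0) :
    ‖normRpowDeriv s z‖ = |s| * ‖z‖ ^ (s - 1) := by
  have hz' : 0 < ‖z‖ := norm_pos_iff.2 hz
  rw [normRpowDeriv, norm_smul, norm_realInnerCLM_apply, norm_mul, Real.norm_eq_abs,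
    Real.norm_of_nonneg (by positivity), mul_assoc, ← Real.rpow_add_one hz'.ne']
  congr 2; ring

theorem norm_normRpowDerivTwo_le (s : ℝ) {z : E} (hz : z ≠ 0) :
    ‖normRpowDerivTwo s z‖ ≤ |s| * (1 + |s - 2|) * ‖z‖ ^ (s - 2) := by
  have hz' : 0 < ‖z‖ := norm_pos_iff.2 hz
  refine (norm_add_le ((s * ‖z‖ ^ (s - 2)) • realInnerCLM E)
    ((s • normRpowDeriv (s - 2) z).smulRight (realInnerCLM E z))).trans ?_
  rw [ContinuousLinearMap.norm_smulRight_apply, norm_smul_continuousLinearMap (F := E →L[ℝ] ℝ), norm_smul,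
    norm_normRpowDeriv _ hz,
    norm_realInnerCLM_apply, norm_mul, Real.norm_eq_abs, Real.norm_of_nonneg (by positivity)]
  have h1 : |s| * ‖z‖ ^ (s - 2) * ‖realInnerCLM E‖ ≤ |s| * ‖z‖ ^ (s - 2) :=
    mul_le_of_le_one_right (by positivity) norm_realInnerCLM_le
  have h2 : ‖z‖ ^ (s - 2 - 1) * ‖z‖ = ‖z‖ ^ (s - 2) := by
    rw [← Real.rpow_add_one hz'.ne']; congr 1; ring
  linear_combination h1 + |s| * |s - 2| * h2

theorem sum_normRpowDerivTwo {ι : Type*} [Fintype ι] (b : OrthonormalBasis ι ℝ E) (s : ℝ)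
    (hs : s = 2 - Fintype.card ι) {z : E} (hz : z ≠ 0) :
    ∑ j, normRpowDerivTwo s z (b j) (b j) = 0 := by
  have hz' : 0 < ‖z‖ := norm_pos_iff.2 hz
  have h1 : ∀ j, normRpowDerivTwo s z (b j) (b j) =
      s * ‖z‖ ^ (s - 2) + s * (s - 2) * ‖z‖ ^ (s - 2 - 2) * inner ℝ z (b j) ^ 2 := fun j => by
    simp [normRpowDerivTwo, normRpowDeriv, realInnerCLM_apply]
    ring
  have h2 : ‖z‖ ^ (s - 2 - 2) * ‖z‖ ^ 2 = ‖z‖ ^ (s - 2) := by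
    rw [← Real.rpow_natCast, ← Real.rpow_add hz']; norm_num
  simp only [h1]
  rw [Finset.sum_add_distrib, ← Finset.mul_sum Finset.univ (fun j => inner ℝ z (b j) ^ 2), b.sum_sq_inner_left, mul_assoc _ _ (‖z‖ ^ 2), h2]
  simp only [Finset.sum_const, Finset.card_univ, nsmul_eq_mul]
  rw [show (Fintype.card ι : ℝ) = 2 - s by linarith]
  ring

end RieszPotential

section PoleSeries

variable {ι E : Type*} [NormedAddCommGroup E]

/-- Poles that are summably sparse stay away from any point which is not one of them, on a scale
proportional to their norm. -/
theorem exists_mul_one_add_norm_le {p : ι → E} {s : ℝ} (hs : s < 0)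
    (hp : Summable fun i => (1 + ‖p i‖) ^ s) {x₀ : E} (hx₀ : ∀ i, x₀ ≠ p i) :
    ∃ c > 0, ∀ x ∈ Metric.ball x₀ c, ∀ i, c * (1 + ‖p i‖) ≤ ‖x - p i‖ := by
  suffices ∃ c > 0, ∀ i, c * (1 + ‖p i‖) ≤ ‖x₀ - p i‖ by
    obtain ⟨c, hc, h⟩ := this
    refine ⟨c / 2, by positivity, fun x hx i => ?_⟩
    have h1 : ‖x - x₀‖ < c / 2 := by simpa [dist_eq_norm] using hx
    have h2 := norm_sub_le_norm_sub_add_norm_sub x₀ x (p i)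
    rw [norm_sub_rev x₀ x] at h2
    nlinarith [h i, norm_nonneg (p i)]
  set R : ℝ := 2 * (1 + ‖x₀‖)
  have hR : 0 < R := by positivity
  have hF : {i | ¬ R < 1 + ‖p i‖}.Finite := by
    have := hp.tendsto_cofinite_zero.eventually (gt_mem_nhds (Real.rpow_pos_of_pos hR s))
    refine this.mono fun i hi => ?_
    rwa [Real.rpow_lt_rpow_iff_of_neg (by positivity) hR hs] at hi
  obtain ⟨d, hd, hdF⟩ : ∃ d > 0, ∀ i ∈ hF.toFinset, d ≤ ‖x₀ - p i‖ := by
    rcases hF.toFinset.eq_empty_or_nonempty with h | h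
    · exact ⟨1, one_pos, by rw [h]; simp⟩
    · obtain ⟨i, -, hi⟩ := hF.toFinset.exists_min_image (fun i => ‖x₀ - p i‖) h
      exact ⟨_, norm_pos_iff.2 (sub_ne_zero.2 (hx₀ i)), hi⟩
  refine ⟨min (1 / 2) (d / R), by positivity, fun i => ?_⟩
  by_cases hi : R < 1 + ‖p i‖
  · have h1 : min (1 / 2) (d / R) * (1 + ‖p i‖) ≤ 1 / 2 * (1 + ‖p i‖) := by
      gcongr; exact min_le_left _ _
    have h2 := norm_sub_norm_le (p i) x₀
    rw [norm_sub_rev] at h2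
    linarith
  · calc min (1 / 2) (d / R) * (1 + ‖p i‖) ≤ d / R * R := by
          gcongr
          · exact min_le_right _ _
          · exact not_lt.1 hi
      _ = d := by field_simp
      _ ≤ _ := hdF i (by simpa using hi)

theorem rpow_sub_le_of_mul_one_add_le {c a b s t : ℝ} (hc : 0 < c) (ha : 0 ≤ a)
    (hb : c * (1 + a) ≤ b) (hs : s ≤ 0) (ht : 0 ≤ t) :
    b ^ (s - t) ≤ c ^ (s - t) * (1 + a) ^ s := by
  calc b ^ (s - t) ≤ (c * (1 + a)) ^ (s - t) :=
        Real.rpow_le_rpow_of_nonpos (by positivity) hb (by linarith)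
    _ = c ^ (s - t) * (1 + a) ^ (s - t) := Real.mul_rpow hc.le (by positivity)
    _ ≤ c ^ (s - t) * (1 + a) ^ s := by
        gcongr <;> linarith

theorem summable_norm_sub_rpow {p : ι → E} {s : ℝ} (hs : s < 0)
    (hp : Summable fun i => (1 + ‖p i‖) ^ s) {x₀ : E} (hx₀ : ∀ i, x₀ ≠ p i) :
    Summable fun i => ‖x₀ - p i‖ ^ s := by
  obtain ⟨c, hc, h⟩ := exists_mul_one_add_norm_le hs hp hx₀
  refine .of_nonneg_of_le (fun i => by positivity) (fun i => ?_) (hp.mul_left (c ^ s))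
  simpa using rpow_sub_le_of_mul_one_add_le hc (norm_nonneg _)
    (h x₀ (Metric.mem_ball_self hc) i) hs.le le_rfl

variable [InnerProductSpace ℝ E]

theorem summable_continuousLinearMap {F : Type*} [NormedAddCommGroup F] [NormedSpace ℝ F]
    [CompleteSpace F] {A : ι → E →L[ℝ] F} {u : ι → ℝ} (hu : Summable u)
    (h : ∀ i, ‖A i‖ ≤ u i) : Summable A :=
  .of_norm_bounded hu h

theorem continuousOn_tsum_continuousLinearMap {F : Type*} [NormedAddCommGroup F]
    [NormedSpace ℝ F] [CompleteSpace F] {A : ι → E → E →L[ℝ] F} {u : ι → ℝ} {t : Set E}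
    (hA : ∀ i, ContinuousOn (A i) t) (hu : Summable u) (h : ∀ i, ∀ x ∈ t, ‖A i x‖ ≤ u i) :
    ContinuousOn (fun x => ∑' i, A i x) t :=
  continuousOn_tsum hA hu h

theorem hasFDerivAt_tsum_sub {F : Type*} [NormedAddCommGroup F] [NormedSpace ℝ F]
    [CompleteSpace F] {g : E → F} {g' : E → E →L[ℝ] F} {p : ι → E} {u : ι → ℝ} {t : Set E}
    (hu : Summable u) (ht : IsOpen t) (htc : Convex ℝ t)
    (hg : ∀ x ∈ t, ∀ i, HasFDerivAt g (g' (x - p i)) (x - p i))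
    (hb : ∀ i, ∀ x ∈ t, ‖g' (x - p i)‖ ≤ u i) {x₀ x : E} (hx₀ : x₀ ∈ t)
    (h₀ : Summable fun i => g (x₀ - p i)) (hx : x ∈ t) :
    HasFDerivAt (fun x => ∑' i, g (x - p i)) (∑' i, g' (x - p i)) x :=
  hasFDerivAt_tsum_of_isPreconnected (f := fun i x => g (x - p i))
    (f' := fun i x => g' (x - p i)) hu ht htc.isPreconnected
    (fun i x hx => (hg x hx i).comp x ((hasFDerivAt_id x).sub_const (p i))) hb hx₀ h₀ hx

theorem exists_hasFDerivAt_tsum_norm_sub_rpow {p : ι → E} {s : ℝ} (hs : s < 0)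
    (hp : Summable fun i => (1 + ‖p i‖) ^ s) {x₀ : E} (hx₀ : ∀ i, x₀ ≠ p i) :
    ∃ c > 0,
      (∀ x ∈ Metric.ball x₀ c, HasFDerivAt (fun x => ∑' i, ‖x - p i‖ ^ s)
        (∑' i, normRpowDeriv s (x - p i)) x) ∧
      (∀ x ∈ Metric.ball x₀ c, HasFDerivAt (fun x => ∑' i, normRpowDeriv s (x - p i))
        (∑' i, normRpowDerivTwo s (x - p i)) x) ∧
      ContinuousOn (fun x => ∑' i, normRpowDerivTwo s (x - p i)) (Metric.ball x₀ c) ∧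
      Summable (fun i => normRpowDerivTwo s (x₀ - p i)) := by
  obtain ⟨c, hc, h⟩ := exists_mul_one_add_norm_le hs hp hx₀
  have hx₀c := Metric.mem_ball_self (x := x₀) hc
  have hne : ∀ x ∈ Metric.ball x₀ c, ∀ i, x - p i ≠ 0 := fun x hx i => by
    rw [← norm_pos_iff]
    exact lt_of_lt_of_le (by positivity) (h x hx i)
  have hu1 := (hp.mul_left (c ^ (s - 1))).mul_left |s|
  have hu2 := (hp.mul_left (c ^ (s - 2))).mul_left (|s| * (1 + |s - 2|))
  have hb1 : ∀ i, ∀ x ∈ Metric.ball x₀ c, ‖normRpowDeriv s (x - p i)‖ ≤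
      |s| * (c ^ (s - 1) * (1 + ‖p i‖) ^ s) := fun i x hx => by
    rw [norm_normRpowDeriv _ (hne x hx i)]
    gcongr
    exact rpow_sub_le_of_mul_one_add_le hc (norm_nonneg _) (h x hx i) hs.le zero_le_one
  have hb2 : ∀ i, ∀ x ∈ Metric.ball x₀ c, ‖normRpowDerivTwo s (x - p i)‖ ≤
      |s| * (1 + |s - 2|) * (c ^ (s - 2) * (1 + ‖p i‖) ^ s) := fun i x hx => by
    refine (norm_normRpowDerivTwo_le _ (hne x hx i)).trans ?_
    gcongr
    exact rpow_sub_le_of_mul_one_add_le hc (norm_nonneg _) (h x hx i) hs.le zero_le_two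
  have hs1 : Summable fun i => normRpowDeriv s (x₀ - p i) :=
    .of_norm_bounded hu1 fun i => hb1 i x₀ hx₀c
  refine ⟨c, hc, fun x hx => ?_, fun x hx => ?_, ?_,
    summable_continuousLinearMap (F := E →L[ℝ] ℝ) hu2 fun i => hb2 i x₀ hx₀c⟩
  · exact hasFDerivAt_tsum_sub hu1 Metric.isOpen_ball (convex_ball x₀ c)
      (fun x hx i => hasFDerivAt_norm_rpow_of_ne s (hne x hx i)) hb1 hx₀c
      (summable_norm_sub_rpow hs hp hx₀) hx
  · exact hasFDerivAt_tsum_sub (F := E →L[ℝ] ℝ) hu2 Metric.isOpen_ball (convex_ball x₀ c)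
      (fun x hx i => hasFDerivAt_normRpowDeriv s (hne x hx i)) hb2 hx₀c hs1 hx
  · exact continuousOn_tsum_continuousLinearMap (F := E →L[ℝ] ℝ) (fun i x hx =>
      ((continuousAt_normRpowDerivTwo s (hne x hx i)).comp
        (f := fun x => x - p i) (by fun_prop)).continuousWithinAt) hu2 hb2

theorem contDiffAt_tsum_norm_sub_rpow {p : ι → E} {s : ℝ} (hs : s < 0)
    (hp : Summable fun i => (1 + ‖p i‖) ^ s) {x₀ : E} (hx₀ : ∀ i, x₀ ≠ p i) :
    ContDiffAt ℝ 2 (fun x => ∑' i, ‖x - p i‖ ^ s) x₀ := by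
  obtain ⟨c, hc, h1, h2, h3, -⟩ := exists_hasFDerivAt_tsum_norm_sub_rpow hs hp hx₀
  refine ContDiffOn.contDiffAt (s := Metric.ball x₀ c) ?_ (Metric.ball_mem_nhds _ hc)
  rw [show (2 : WithTop ℕ∞) = 0 + 1 + 1 by norm_num,
    contDiffOn_succ_iff_fderiv_of_isOpen Metric.isOpen_ball]
  refine ⟨fun x hx => (h1 x hx).differentiableAt.differentiableWithinAt, by simp, ?_⟩
  refine ContDiffOn.congr ?_ fun x hx => (h1 x hx).fderiv
  rw [contDiffOn_succ_iff_fderiv_of_isOpen Metric.isOpen_ball, contDiffOn_zero]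
  exact ⟨fun x hx => (h2 x hx).differentiableAt.differentiableWithinAt, by simp,
    h3.congr fun x hx => (h2 x hx).fderiv⟩

theorem sum_fderiv_fderiv_tsum_norm_sub_rpow {κ : Type*} [Fintype κ]
    (b : OrthonormalBasis κ ℝ E) {p : ι → E} {s : ℝ} (hs : s < 0)
    (hsκ : s = 2 - Fintype.card κ)
    (hp : Summable fun i => (1 + ‖p i‖) ^ s) {x₀ : E} (hx₀ : ∀ i, x₀ ≠ p i) :
    ∑ j, fderiv ℝ (fun z => fderiv ℝ (fun x => ∑' i, ‖x - p i‖ ^ s) z (b j)) x₀ (b j) = 0 := by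
  obtain ⟨c, hc, h1, h2, -, h4⟩ := exists_hasFDerivAt_tsum_norm_sub_rpow hs hp hx₀
  have key : ∀ j, fderiv ℝ (fun z => fderiv ℝ (fun x => ∑' i, ‖x - p i‖ ^ s) z (b j)) x₀ (b j) =
      (∑' i, normRpowDerivTwo s (x₀ - p i)) (b j) (b j) := fun j => by
    have e : (fun z => fderiv ℝ (fun x => ∑' i, ‖x - p i‖ ^ s) z (b j)) =ᶠ[𝓝 x₀]
        fun z => (∑' i, normRpowDeriv s (z - p i)) (b j) := by
      filter_upwards [Metric.ball_mem_nhds x₀ hc] with z hz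
      rw [(h1 z hz).fderiv]
    rw [e.fderiv_eq, ((h2 x₀ (Metric.mem_ball_self hc)).clm_apply
      (hasFDerivAt_const (b j) x₀)).fderiv]
    simp
  let T : (E →L[ℝ] E →L[ℝ] ℝ) →L[ℝ] ℝ := ∑ j,
    (ContinuousLinearMap.apply ℝ ℝ (b j)).comp (ContinuousLinearMap.apply ℝ (E →L[ℝ] ℝ) (b j))
  have hT : ∀ A, T A = ∑ j, A (b j) (b j) := fun A => by simp [T]
  simp only [key]
  rw [← hT, T.map_tsum h4]
  simp only [hT, sum_normRpowDerivTwo b s hsκ (sub_ne_zero.2 (hx₀ _)), tsum_zero]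

end PoleSeries

section Lattice

theorem summable_one_add_norm_intCast_rpow {k : ℕ} {r : ℝ} (hr : r < -k) :
    Summable fun m : Fin k → ℤ => (1 + ‖fun i => (m i : ℝ)‖) ^ r := by
  let b := (Pi.basisFun ℝ (Fin k)).restrictScalars ℤ
  have hfin : Module.finrank ℤ (Submodule.span ℤ (Set.range (Pi.basisFun ℝ (Fin k)))) = k := by
    rw [Module.finrank_eq_card_basis b, Fintype.card_fin]
  have h := ZLattice.summable_norm_rpow
    (Submodule.span ℤ (Set.range (Pi.basisFun ℝ (Fin k)))) r (by rwa [hfin])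
  have h' := (Equiv.summable_iff b.equivFun.symm.toEquiv).2 h
  have e : ∀ m : Fin k → ℤ, ((b.equivFun.symm m : Submodule.span ℤ _) : Fin k → ℝ) =
      fun i => (m i : ℝ) := fun m => by
    ext i
    simp [b, Module.Basis.equivFun_symm_apply, Pi.single_apply]
  refine .of_norm_bounded_eventually h' ?_
  filter_upwards [(Set.finite_singleton (0 : Fin k → ℤ)).compl_mem_cofinite] with m hm
  have hm' : (fun i => (m i : ℝ)) ≠ 0 := fun h0 => hm (by
    ext i; have := congrFun h0 i; simpa using this)
  have hpos := norm_pos_iff.2 hm'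
  rw [Real.norm_of_nonneg (by positivity)]
  simp only [Function.comp, LinearEquiv.coe_toEquiv, Submodule.coe_norm, e]
  exact Real.rpow_le_rpow_of_nonpos hpos (by linarith) (by
    have : (0 : ℝ) ≤ k := by positivity
    linarith)

theorem summable_one_add_rpow_of_le {ι : Type*} {f g : ι → ℝ} {C s : ℝ} (hC : 0 < C) (hs : s ≤ 0)
    (hf : ∀ i, 0 ≤ f i) (hg : ∀ i, 0 ≤ g i) (hfg : ∀ i, f i ≤ C * (1 + g i))
    (h : Summable fun i => (1 + f i) ^ s) : Summable fun i => (1 + g i) ^ s := by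
  refine .of_nonneg_of_le (fun i => by have := hg i; positivity) (fun i => ?_)
    (h.mul_left ((1 + C)⁻¹ ^ s))
  have := hf i
  have := hg i
  rw [← Real.mul_rpow (by positivity) (by positivity)]
  refine Real.rpow_le_rpow_of_nonpos (by positivity) ?_ hs
  rw [inv_mul_le_iff₀ (by positivity)]
  nlinarith [hfg i]

theorem summable_one_add_norm_latt_rpow {n k : ℕ} {v : Fin k → Euc n}
    (hv : LinearIndependent ℝ v) {r : ℝ} (hr : r < -k) :
    Summable fun m : Fin k → ℤ => (1 + ‖latt v m‖) ^ r := by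
  obtain ⟨K, hK, h⟩ := (Fintype.linearCombination ℝ v).exists_antilipschitzWith
    (LinearMap.ker_eq_bot.2 hv.fintypeLinearCombination_injective)
  refine summable_one_add_rpow_of_le (C := K) (by exact_mod_cast hK) ?_
    (fun m => norm_nonneg _) (fun m => norm_nonneg _) (fun m => ?_)
    (summable_one_add_norm_intCast_rpow hr)
  · have : (0 : ℝ) ≤ k := by positivity
    linarith
  · have := h.le_mul_dist (fun i => (m i : ℝ)) 0
    simp only [map_zero, dist_zero_right, Fintype.linearCombination_apply] at this
    refine this.trans ?_
    have hK' : (0 : ℝ) ≤ K := K.2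
    change (K : ℝ) * ‖latt v m‖ ≤ _
    nlinarith

theorem latt_add {n k : ℕ} (v : Fin k → Euc n) (m m' : Fin k → ℤ) :
    latt v (m + m') = latt v m + latt v m' := by
  simp [latt, add_smul, Finset.sum_add_distrib]

theorem latt_neg {n k : ℕ} (v : Fin k → Euc n) (m : Fin k → ℤ) : latt v (-m) = -latt v m := by
  simp [latt]

theorem latt_apply_eq_zero {n k : ℕ} {v : Fin k → Euc n} {j : Fin n} (hv : ∀ i, v i j = 0)
    (m : Fin k → ℤ) : latt v m j = 0 := by
  simp [latt, hv]

end Lattice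

/-- Möbius-type twisted translations `γ_ω(x) = (x̄+ω, x_{k+1},…,x_{n-1},
sgn(ω)·x_n)`, written as `γ_ω(x) = x + ω + ((sgn(ω)-1)·x_n) e_n` with
`sgn(m₁v₁+⋯+m_kv_k) = (-1)^{m₁+⋯+m_k}`: (i) the family `(|γ_ω(x)-y|^{2-n})_{ω∈Λ}` is
summable whenever `γ_ω(x) ≠ y` for all `ω`, so `H⁻(x,y) = Σ_ω |γ_ω(x)-y|^{2-n}` is well
defined; (ii) `H⁻(γ_η(x),y) = H⁻(x,y)` for every `η ∈ Λ`; (iii) for fixed `y`, `x ↦ H⁻(x,y)`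
is harmonic on `{x : γ_ω(x) ≠ y for all ω}`. -/
theorem stmt12 (n k : ℕ) (hn : 4 ≤ n) (hk1 : 1 ≤ k) (hk2 : k ≤ n - 3)
    (v : Fin k → Euc n) (hv : LinearIndependent ℝ v)
    (hv0 : ∀ (i : Fin k) (j : Fin n), k ≤ (j : ℕ) → v i j = 0)
    (γ : (Fin k → ℤ) → Euc n → Euc n)
    (hγ : ∀ (m : Fin k → ℤ) (x : Euc n),
      γ m x = x + latt v m +
        (((-1 : ℝ) ^ (∑ i, m i) - 1) * x ⟨n - 1, by omega⟩) •
          EuclideanSpace.single ⟨n - 1, by omega⟩ 1)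
    (H : Euc n → Euc n → ℝ)
    (hH : ∀ x y : Euc n, H x y = ∑' m : Fin k → ℤ, ‖γ m x - y‖ ^ (2 - (n : ℝ))) :
    (∀ x y : Euc n, (∀ m : Fin k → ℤ, γ m x ≠ y) →
      Summable (fun m : Fin k → ℤ => ‖γ m x - y‖ ^ (2 - (n : ℝ)))) ∧
    (∀ x y : Euc n, (∀ m : Fin k → ℤ, γ m x ≠ y) →
      ∀ η : Fin k → ℤ, H (γ η x) y = H x y) ∧
    (∀ y : Euc n,
      ContDiffOn ℝ 2 (fun x => H x y) {x | ∀ m : Fin k → ℤ, γ m x ≠ y} ∧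
      ∀ x : Euc n, (∀ m : Fin k → ℤ, γ m x ≠ y) →
        ∑ j : Fin n,
          fderiv ℝ (fun z => fderiv ℝ (fun x' => H x' y) z (EuclideanSpace.single j 1)) x
            (EuclideanSpace.single j 1) = 0) := by
  have hn' : (4 : ℝ) ≤ n := by exact_mod_cast hn
  have hkn : (2 - n : ℝ) < -k := by
    have : k + 3 ≤ n := by omega
    have : (k + 3 : ℝ) ≤ n := by exact_mod_cast this
    linarith
  have hs : (2 - n : ℝ) < 0 := by linarith
  let l : Fin n := ⟨n - 1, by omega⟩
  have hlatt : ∀ m, latt v m l = 0 :=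
    latt_apply_eq_zero fun i => hv0 i l (show k ≤ n - 1 by omega)
  have hγl : ∀ m x, γ m x l = (-1 : ℝ) ^ (∑ i, m i) * x l := fun m x => by
    rw [hγ]
    simp only [PiLp.add_apply, PiLp.smul_apply, hlatt, smul_eq_mul]
    rw [show (⟨n - 1, by omega⟩ : Fin n) = l from rfl, PiLp.single_apply, if_pos rfl]
    ring
  have hγj : ∀ m x, ∀ j ≠ l, γ m x j = x j + latt v m j := fun m x j hj => by
    rw [hγ]
    simp only [PiLp.add_apply, PiLp.smul_apply, smul_eq_mul]
    rw [show (⟨n - 1, by omega⟩ : Fin n) = l from rfl, PiLp.single_apply, if_neg hj]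
    ring
  have hγγ : ∀ m η x, γ m (γ η x) = γ (m + η) x := fun m η x => by
    ext j
    by_cases hj : j = l
    · subst hj
      simp only [hγl, Pi.add_apply, Finset.sum_add_distrib]
      rw [zpow_add₀ (by norm_num)]
      ring
    · simp only [hγj _ _ j hj, latt_add, PiLp.add_apply]
      ring
  have hsgn : ∀ a : ℤ, (-1 : ℝ) ^ a = 1 ∨ (-1 : ℝ) ^ a = -1 := fun a => by
    rcases Int.even_or_odd a with h | h
    · exact Or.inl h.neg_one_zpow
    · exact Or.inr h.neg_one_zpow
  have hdist : ∀ m x y, ‖γ m x - y‖ = ‖x - γ (-m) y‖ := fun m x y => by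
    rw [EuclideanSpace.norm_eq, EuclideanSpace.norm_eq]
    congr 1
    refine Finset.sum_congr rfl fun j _ => ?_
    rw [Real.norm_eq_abs, Real.norm_eq_abs, sq_abs, sq_abs]
    by_cases hj : j = l
    · subst hj
      simp only [PiLp.sub_apply, hγl, Pi.neg_apply, Finset.sum_neg_distrib, zpow_neg]
      rcases hsgn (∑ i, m i) with h | h <;> (rw [h]; norm_num; try ring)
    · simp only [PiLp.sub_apply, hγj _ _ j hj, latt_neg, PiLp.neg_apply]
      ring
  have hne : ∀ x y, (∀ m, γ m x ≠ y) → ∀ m, x ≠ γ (-m) y := fun x y h m => by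
    rw [← sub_ne_zero, ← norm_pos_iff, ← hdist, norm_pos_iff, sub_ne_zero]
    exact h m
  have hγ0 : ∀ m, γ m 0 = latt v m := fun m => by simp [hγ]
  have hp : ∀ y, Summable fun m => (1 + ‖γ (-m) y‖) ^ (2 - n : ℝ) := fun y => by
    refine summable_one_add_rpow_of_le (C := 1 + ‖y‖) (by positivity) hs.le
      (fun m => norm_nonneg (latt v m)) (fun m => norm_nonneg _) (fun m => ?_)
      (summable_one_add_norm_latt_rpow hv hkn)
    have h1 : ‖latt v m - y‖ = ‖γ (-m) y‖ := by rw [← hγ0, hdist, zero_sub, norm_neg]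
    have h2 := norm_sub_norm_le (latt v m) y
    nlinarith [norm_nonneg y, norm_nonneg (γ (-m) y)]
  have hHeq : ∀ y, (fun x => H x y) = fun x => ∑' m, ‖x - γ (-m) y‖ ^ (2 - n : ℝ) := fun y => by
    ext x
    simp only [hH, hdist]
  refine ⟨fun x y h => ?_, fun x y _ η => ?_, fun y => ⟨fun x hx => ?_, fun x hx => ?_⟩⟩
  · simp only [hdist]
    exact summable_norm_sub_rpow hs (hp y) (hne x y h)
  · simp only [hH, hγγ]
    exact (Equiv.addRight η).tsum_eq fun m => ‖γ m x - y‖ ^ (2 - n : ℝ)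
  · rw [hHeq]
    exact (contDiffAt_tsum_norm_sub_rpow hs (hp y) (hne x y hx)).contDiffWithinAt
  · simp only [hHeq]
    simpa using sum_fderiv_fderiv_tsum_norm_sub_rpow (EuclideanSpace.basisFun (Fin n) ℝ) hs
      (by simp) (hp y) (hne x y hx)
end
end
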